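/- Let μ be a Borel probability measure on a compact interval 𝕀 ⊂ ℝ of positive length, and n ∈ ℕ. For every p ∈ Π_n there exists a best Kolmogorov-distance approximation of μ given p, i.e. x* ∈ Ξ_n minimizing x ↦ d_K(μ, δ_x^p). Moreover, d_K(μ, δ_x^p) = min_{y∈Ξ_n} d_K(μ, δ_y^p) if and only if for every j = 1,…,n with P_{j−1} < P_j: F⁻¹_{μ−}(P_j − K_•(p)) ≤ x_j ≤ F_μ⁻¹(P_{j−1} + K_•(p)); and in this case d_K(μ, δ_x^p) = K_•(p). -/

import Mathlib

open MeasureTheory Filter Set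

noncomputable section

namespace BenfordApprox

/-- Right-hand limit `f₊` of a nondecreasing `f : ℝ → ℝ̄`, at an extended-real point. -/
def fplus (f : ℝ → EReal) (a : EReal) : EReal := sInf (f '' {x : ℝ | a < (x : EReal)})

/-- Left-hand limit `f₋` of a nondecreasing `f : ℝ → ℝ̄`, at an extended-real point. -/
def fminus (f : ℝ → EReal) (a : EReal) : EReal := sSup (f '' {x : ℝ | (x : EReal) < a})

/-- The (upper) inverse function `f⁻¹(t) = sup {x : f x ≤ t}` (with `sup ∅ = ⊥`). -/
def upperInv (f : ℝ → EReal) (t : ℝ) : EReal :=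
  sSup ((fun x : ℝ => (x : EReal)) '' {x : ℝ | f x ≤ (t : EReal)})

/-- The upper inverse, for an extended-real argument. -/
def upperInvE (f : ℝ → EReal) (t : EReal) : EReal :=
  sSup ((fun x : ℝ => (x : EReal)) '' {x : ℝ | f x ≤ t})

/-- Lévy-type distance `d_L(f,g)` between nondecreasing functions `f g : ℝ → ℝ̄`. -/
def dLfun (f g : ℝ → EReal) : EReal :=
  sInf ((fun y : ℝ => (y : EReal)) ''
    {y : ℝ | 0 ≤ y ∧ ∀ x : ℝ, f (x - y) - (y : EReal) ≤ g x ∧ g x ≤ f (x + y) + (y : EReal)})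

/-- The auxiliary function `ℓ_{f,I}`; it depends on `I` only through `lo = inf I`, `hi = sup I`. -/
def ell (f : ℝ → EReal) (lo hi : EReal) (x : ℝ) : ℝ :=
  sInf {y : ℝ | 0 ≤ y ∧ fminus f (hi - (y : EReal)) - (y : EReal) ≤ (x : EReal) ∧
    (x : EReal) ≤ fplus f (lo + (y : EReal)) + (y : EReal)}

/-- The minimal value `ℓ*_{f,I} = min {y ≥ 0 : f₋(sup I − y) − y ≤ f₊(inf I + y) + y}`. -/
def ellStar (f : ℝ → EReal) (lo hi : EReal) : ℝ :=
  sInf {y : ℝ | 0 ≤ y ∧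
    fminus f (hi - (y : EReal)) - (y : EReal) ≤ fplus f (lo + (y : EReal)) + (y : EReal)}

/-- Distribution function `F_μ(t) = μ {y ∈ 𝕀 : y ≤ t}` of `μ`, where `𝕀 = [A,B]`. -/
def cdf (μ : Measure ℝ) (A B : ℝ) (t : ℝ) : ℝ := (μ (Icc A B ∩ Iic t)).toReal

/-- `F_μ` evaluated at an extended-real point (so `F_μ(−∞) = 0`, `F_μ(+∞) = 1`). -/
def cdfE (μ : Measure ℝ) (A B : ℝ) (a : EReal) : ℝ :=
  (μ (Icc A B ∩ {y : ℝ | (y : EReal) ≤ a})).toReal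

/-- Left limit `F_{μ−}` at an extended-real point (so `F_{μ−}(−∞) = 0`, `F_{μ−}(+∞) = 1`). -/
def cdfL (μ : Measure ℝ) (A B : ℝ) (a : EReal) : ℝ :=
  sSup ((cdf μ A B) '' {t : ℝ | (t : EReal) < a})

/-- Left limit `F_{μ−}` at a real point. -/
def cdfm (μ : Measure ℝ) (A B : ℝ) (t : ℝ) : ℝ := sSup ((cdf μ A B) '' Iio t)

/-- The (upper) quantile function `F_μ⁻¹` of `μ` on `𝕀 = [A,B]`, extended monotonically to `ℝ`. -/
def quant (μ : Measure ℝ) (A B : ℝ) (t : ℝ) : ℝ :=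
  if t < (μ {A}).toReal ∨ t < 0 then A
  else sSup {y ∈ Icc A B | cdf μ A B y ≤ t}

/-- Left limit `F⁻¹_{μ−}` of the quantile function. -/
def quantm (μ : Measure ℝ) (A B : ℝ) (t : ℝ) : ℝ := sSup ((quant μ A B) '' Iio t)

/-- `F_μ` as a function into the extended reals. -/
def cdfEReal (μ : Measure ℝ) (A B : ℝ) : ℝ → EReal := fun t => ((cdf μ A B t : ℝ) : EReal)

/-- `F_μ⁻¹` as a function into the extended reals. -/
def quantEReal (μ : Measure ℝ) (A B : ℝ) : ℝ → EReal := fun t => ((quant μ A B t : ℝ) : EReal)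

/-- The finitely supported measure `δ_x^p = Σ_j p_j δ_{x_j}`. -/
def discr (n : ℕ) (x p : Fin n → ℝ) : Measure ℝ :=
  ∑ j : Fin n, ENNReal.ofReal (p j) • Measure.dirac (x j)

/-- `p ∈ Π_n`: a probability vector. -/
def IsPi (n : ℕ) (p : Fin n → ℝ) : Prop := (∀ j, 0 ≤ p j) ∧ ∑ j, p j = 1

/-- `x ∈ Ξ_n`: a nondecreasing vector of locations in `𝕀 = [A,B]`. -/
def IsXi (A B : ℝ) (n : ℕ) (x : Fin n → ℝ) : Prop := (∀ j, x j ∈ Icc A B) ∧ Monotone x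

/-- The uniform weight vector `u_n = (1/n, …, 1/n)`. -/
def unif (n : ℕ) : Fin n → ℝ := fun _ => 1 / (n : ℝ)

/-- Partial sums `P_i = Σ_{j<i} p_j` (so `P_0 = 0`, `P_n = 1`). -/
def psum (n : ℕ) (p : Fin n → ℝ) (i : ℕ) : ℝ := ∑ j : Fin n, if (j : ℕ) < i then p j else 0

/-- Locations extended by `x_0 = −∞`, `x_{n+1} = +∞`; here `extPts n x j` is the paper's `x_j`. -/
def extPts (n : ℕ) (x : Fin n → ℝ) : ℕ → EReal := fun j =>
  if hj : j = 0 then ⊥ else if h : j ≤ n then ((x ⟨j - 1, by omega⟩ : ℝ) : EReal) else ⊤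

/-- `xcoord n x j` is the paper's `x_{j+1}` (0-based access). -/
def xcoord (n : ℕ) (x : Fin n → ℝ) (j : ℕ) : ℝ := if h : j < n then x ⟨j, h⟩ else 0

/-- The normalizing constant `ω = max{1, λ(𝕀)}/λ(𝕀)` for `𝕀 = [A,B]`. -/
def omegaI (A B : ℝ) : ℝ := max 1 (B - A) / (B - A)

/-- Lévy distance between Borel measures on `𝕀 = [A,B]`. -/
def dLevy (A B : ℝ) (μ ν : Measure ℝ) : ℝ :=
  omegaI A B * sInf {y : ℝ | 0 ≤ y ∧
    ∀ t : ℝ, cdf μ A B (t - y) - y ≤ cdf ν A B t ∧ cdf ν A B t ≤ cdf μ A B (t + y) + y}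

/-- Kolmogorov (uniform) distance between Borel measures on `𝕀 = [A,B]`. -/
def dKol (A B : ℝ) (μ ν : Measure ℝ) : ℝ :=
  sSup (Set.range fun t : ℝ => |cdf μ A B t - cdf ν A B t|)

/-- `L¹`-Kantorovich distance between Borel measures on `𝕀 = [A,B]`. -/
def dKant1 (A B : ℝ) (μ ν : Measure ℝ) : ℝ :=
  (B - A)⁻¹ * ∫ y in Ioo (0 : ℝ) 1, |quant μ A B y - quant ν A B y|

/-- `L^r`-Kantorovich distance between Borel measures on `𝕀 = [A,B]`. -/
def dKant (A B r : ℝ) (μ ν : Measure ℝ) : ℝ :=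
  (B - A)⁻¹ * (∫ y in Ioo (0 : ℝ) 1, |quant μ A B y - quant ν A B y| ^ r) ^ (1 / r)

/-- The Benford measure `β_b` on `[1,b]`: the law of `b^U` with `U` uniform on `[0,1)`. -/
def benford (b : ℝ) : Measure ℝ := (volume.restrict (Ico (0 : ℝ) 1)).map (fun t : ℝ => b ^ t)

/-- The map `T_{f,a}(x) = f₊(f⁻¹(x+a) + 2a) + a`. -/
def Tmap (f : ℝ → EReal) (a : ℝ) : EReal → EReal :=
  fun x => fplus f (upperInvE f (x + (a : EReal)) + ((2 * a : ℝ) : EReal)) + (a : EReal)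

/-- The map `S_{f,a}(x) = f₊(f⁻¹(x+a)) + a`. -/
def Smap (f : ℝ → EReal) (a : ℝ) : EReal → EReal :=
  fun x => fplus f (upperInvE f (x + (a : EReal))) + (a : EReal)

/-- `L_•^{•,n} = min {a ≥ 0 : T_{F_μ,a}^{[n]}(0) ≥ 1}`. -/
def LBB (μ : Measure ℝ) (A B : ℝ) (n : ℕ) : ℝ :=
  sInf {a : ℝ | 0 ≤ a ∧ (1 : EReal) ≤ (Tmap (cdfEReal μ A B) a)^[n] ((0 : ℝ) : EReal)}

/-- `K_•^{•,n} = min {a ≥ 0 : S_{F_μ,a}^{[n]}(0) ≥ 1}`. -/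
def KBB (μ : Measure ℝ) (A B : ℝ) (n : ℕ) : ℝ :=
  sInf {a : ℝ | 0 ≤ a ∧ (1 : EReal) ≤ (Smap (cdfEReal μ A B) a)^[n] ((0 : ℝ) : EReal)}


/-- The locations `ξ(p)_j = F_μ⁻¹((P_{j−1} + P_j)/2)`. -/
def xiPts (μ : Measure ℝ) (A B : ℝ) (n : ℕ) (p : Fin n → ℝ) : Fin n → ℝ :=
  fun j => quant μ A B ((psum n p (j : ℕ) + psum n p ((j : ℕ) + 1)) / 2)

/-- `K_•(p) = d_K(μ, δ_{ξ(p)}^p)`. -/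
def Kwei (μ : Measure ℝ) (A B : ℝ) (n : ℕ) (p : Fin n → ℝ) : ℝ :=
  dKol A B μ (discr n (xiPts μ A B n p) p)

section Cdf

variable {μ : Measure ℝ} {A B : ℝ}

lemma cdf_nonneg (t : ℝ) : 0 ≤ cdf μ A B t := ENNReal.toReal_nonneg

lemma cdf_le_one [IsProbabilityMeasure μ] (t : ℝ) : cdf μ A B t ≤ 1 :=
  measureReal_le_one (μ := μ)

lemma cdf_mono [IsFiniteMeasure μ] : Monotone (cdf μ A B) := fun _ _ h =>
  ENNReal.toReal_mono (measure_ne_top _ _)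
    (measure_mono (inter_subset_inter_right _ (Iic_subset_Iic.2 h)))

lemma cdf_eq_zero_of_lt {t : ℝ} (ht : t < A) : cdf μ A B t = 0 := by
  have : Icc A B ∩ Iic t = ∅ := by
    ext y
    simp only [mem_inter_iff, mem_Icc, mem_Iic, mem_empty_iff_false, iff_false]
    rintro ⟨⟨h, -⟩, h'⟩
    linarith
  simp [cdf, this]

lemma cdf_right_endpoint (hμ : μ (Icc A B) = 1) : cdf μ A B B = 1 := by
  have : Icc A B ∩ Iic B = Icc A B := inter_eq_left.2 fun y hy => hy.2
  simp [cdf, this, hμ]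

lemma cdf_left_endpoint (hAB : A ≤ B) : cdf μ A B A = (μ {A}).toReal := by
  have : Icc A B ∩ Iic A = {A} := by
    ext y
    simp only [mem_inter_iff, mem_Icc, mem_Iic, mem_singleton_iff]
    constructor
    · rintro ⟨⟨h, -⟩, h'⟩
      exact le_antisymm h' h
    · rintro rfl
      exact ⟨⟨le_rfl, hAB⟩, le_rfl⟩
  rw [cdf, this]

/-- `F_μ` is right-continuous. -/
lemma le_cdf_of_forall_gt [IsProbabilityMeasure μ] {y b t : ℝ}
    (hyb : y < b) (h : ∀ z, y < z → z < b → t ≤ cdf μ A B z) : t ≤ cdf μ A B y := by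
  have hcdf : ∀ z, cdf μ A B z = (μ.restrict (Icc A B)).real (Iic z) := fun z => by
    rw [measureReal_restrict_apply measurableSet_Iic, inter_comm]
    rfl
  have hlim : Tendsto (fun z => (μ.restrict (Icc A B)) (Iic z)) (nhdsWithin y (Ioi y))
      (nhds ((μ.restrict (Icc A B)) (⋂ z > y, Iic z))) :=
    tendsto_measure_biInter_gt (fun _ _ => measurableSet_Iic.nullMeasurableSet)
      (fun _ _ _ hij => Iic_subset_Iic.2 hij) ⟨b, hyb, measure_ne_top _ _⟩
  have hInter : (⋂ z > y, Iic z) = Iic y := by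
    ext w
    simp only [mem_iInter, mem_Iic]
    exact ⟨fun hw => le_of_forall_gt_imp_ge_of_dense hw, fun hw z hz => hw.trans hz.le⟩
  rw [hInter] at hlim
  have hreal := (ENNReal.tendsto_toReal (measure_ne_top _ _)).comp hlim
  rw [hcdf]
  refine ge_of_tendsto hreal ?_
  filter_upwards [Ioo_mem_nhdsGT hyb] with z hz
  exact (h z hz.1 hz.2).trans_eq (hcdf z)

end Cdf

section Quantile

variable {μ : Measure ℝ} {A B : ℝ}

lemma bddAbove_cdf_sublevel (t : ℝ) : BddAbove {y ∈ Icc A B | cdf μ A B y ≤ t} :=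
  ⟨B, fun _ hy => hy.1.2⟩

lemma quant_mem_Icc (hAB : A ≤ B) (t : ℝ) : quant μ A B t ∈ Icc A B := by
  unfold quant
  split_ifs with h
  · exact ⟨le_rfl, hAB⟩
  · push Not at h
    have hA : A ∈ {y ∈ Icc A B | cdf μ A B y ≤ t} :=
      ⟨⟨le_rfl, hAB⟩, (cdf_left_endpoint hAB).trans_le h.1⟩
    exact ⟨le_csSup (bddAbove_cdf_sublevel t) hA, csSup_le ⟨A, hA⟩ fun y hy => hy.1.2⟩

lemma le_quant_of_cdf_le [IsFiniteMeasure μ] (hAB : A ≤ B) {y t : ℝ} (hy : y ∈ Icc A B)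
    (h : cdf μ A B y ≤ t) : y ≤ quant μ A B t := by
  have h1 : (μ {A}).toReal ≤ t := by
    rw [← cdf_left_endpoint hAB]
    exact (cdf_mono hy.1).trans h
  have h2 : 0 ≤ t := ENNReal.toReal_nonneg.trans h1
  rw [quant, if_neg (by push Not; exact ⟨h1, h2⟩)]
  exact le_csSup (bddAbove_cdf_sublevel t) ⟨hy, h⟩

lemma cdf_le_of_lt_quant [IsFiniteMeasure μ] (hAB : A ≤ B) {y t : ℝ} (ht : 0 ≤ t)
    (h : y < quant μ A B t) : cdf μ A B y ≤ t := by
  rcases lt_or_ge y A with hyA | hyA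
  · rwa [cdf_eq_zero_of_lt hyA]
  unfold quant at h
  split_ifs at h with hc
  · exact absurd h (not_lt.2 hyA)
  · by_contra hlt
    push Not at hlt
    push Not at hc
    have hA : A ∈ {y ∈ Icc A B | cdf μ A B y ≤ t} :=
      ⟨⟨le_rfl, hAB⟩, (cdf_left_endpoint hAB).trans_le hc.1⟩
    obtain ⟨z, hz, hyz⟩ := exists_lt_of_lt_csSup ⟨A, hA⟩ h
    exact absurd ((cdf_mono hyz.le).trans hz.2) (not_le.2 hlt)

/-- For `t ≥ 0`, the points below `F_μ⁻¹(t)` are those with `F_{μ−} ≤ t`. -/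
lemma le_quant_iff [IsFiniteMeasure μ] (hAB : A ≤ B) {y t : ℝ} (hy : y ∈ Icc A B)
    (ht : 0 ≤ t) : y ≤ quant μ A B t ↔ ∀ s < y, cdf μ A B s ≤ t := by
  refine ⟨fun h s hs => cdf_le_of_lt_quant hAB ht (hs.trans_le h), fun h => ?_⟩
  by_contra! hlt
  obtain ⟨s, hs, hsy⟩ := exists_between hlt
  have hsI : s ∈ Icc A B := ⟨(quant_mem_Icc hAB t).1.trans hs.le, hsy.le.trans hy.2⟩
  exact absurd (le_quant_of_cdf_le hAB hsI (h s hsy)) (not_le.2 hs)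

lemma le_cdf_of_forall_quant_le [IsProbabilityMeasure μ] (hAB : A ≤ B) (hμ : μ (Icc A B) = 1)
    {y t : ℝ} (hy : y ∈ Icc A B) (ht : t ≤ 1) (h : ∀ s < t, quant μ A B s ≤ y) :
    t ≤ cdf μ A B y := by
  rcases hy.2.eq_or_lt with rfl | hyB
  · rwa [cdf_right_endpoint hμ]
  refine le_cdf_of_forall_gt hyB fun z hyz hzB => ?_
  by_contra! hlt
  exact absurd ((le_quant_of_cdf_le hAB ⟨hy.1.trans hyz.le, hzB.le⟩ le_rfl).trans (h _ hlt))
    (not_le.2 hyz)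

lemma quant_mono [IsFiniteMeasure μ] (hAB : A ≤ B) : Monotone (quant μ A B) := by
  intro s t hst
  rcases lt_or_ge s 0 with hs | hs
  · rw [quant, if_pos (Or.inr hs)]
    exact (quant_mem_Icc hAB t).1
  · rw [le_quant_iff hAB (quant_mem_Icc hAB s) (hs.trans hst)]
    exact fun r hr => (cdf_le_of_lt_quant hAB hs hr).trans hst

lemma le_cdf_quant [IsProbabilityMeasure μ] (hAB : A ≤ B) (hμ : μ (Icc A B) = 1)
    {t : ℝ} (ht : t ≤ 1) : t ≤ cdf μ A B (quant μ A B t) :=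
  le_cdf_of_forall_quant_le hAB hμ (quant_mem_Icc hAB t) ht fun _ hs => quant_mono hAB hs.le

/-- For `t ≤ 1`, the points above `F⁻¹_{μ−}(t)` are those with `F_μ ≥ t`. -/
lemma quantm_le_iff [IsProbabilityMeasure μ] (hAB : A ≤ B) (hμ : μ (Icc A B) = 1)
    {y t : ℝ} (hy : y ∈ Icc A B) (ht : t ≤ 1) :
    quantm μ A B t ≤ y ↔ t ≤ cdf μ A B y := by
  have hbdd : BddAbove (quant μ A B '' Iio t) := by
    refine ⟨B, ?_⟩
    rintro _ ⟨s, -, rfl⟩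
    exact (quant_mem_Icc hAB s).2
  constructor
  · intro h
    exact le_cdf_of_forall_quant_le hAB hμ hy ht fun s hs =>
      (le_csSup hbdd ⟨s, hs, rfl⟩).trans h
  · intro h
    refine csSup_le (nonempty_Iio.image _) ?_
    rintro _ ⟨s, hs, rfl⟩
    rcases lt_or_ge s 0 with hs0 | hs0
    · rw [quant, if_pos (Or.inr hs0)]
      exact hy.1
    · by_contra! hlt
      exact absurd (h.trans (cdf_le_of_lt_quant hAB hs0 hlt)) (not_le.2 hs)

end Quantile

section Discrete

variable {A B : ℝ} {n : ℕ} {x p : Fin n → ℝ}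

lemma cdf_discr (hp : ∀ j, 0 ≤ p j) (hx : ∀ j, x j ∈ Icc A B) (t : ℝ) :
    cdf (discr n x p) A B t = ∑ j, if x j ≤ t then p j else 0 := by
  have hmeas : MeasurableSet (Icc A B ∩ Iic t) := measurableSet_Icc.inter measurableSet_Iic
  rw [cdf, discr, Measure.coe_finsetSum, Finset.sum_apply, ENNReal.toReal_sum]
  · refine Finset.sum_congr rfl fun j _ => ?_
    have hmem : x j ∈ Icc A B ∩ Iic t ↔ x j ≤ t := ⟨fun h => h.2, fun h => ⟨hx j, h⟩⟩
    rw [Measure.smul_apply, Measure.dirac_apply' _ hmeas, smul_eq_mul]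
    by_cases h : x j ≤ t
    · simp [indicator_of_mem (hmem.2 h), h, hp j]
    · simp [h]
  · intro j _
    rw [Measure.smul_apply, smul_eq_mul]
    exact ENNReal.mul_ne_top ENNReal.ofReal_ne_top (measure_ne_top _ _)

lemma isProbabilityMeasure_discr (hp : IsPi n p) : IsProbabilityMeasure (discr n x p) := by
  refine ⟨?_⟩
  simp only [discr, Measure.coe_finsetSum, Finset.sum_apply, Measure.smul_apply, measure_univ,
    smul_eq_mul, mul_one]
  rw [← ENNReal.ofReal_sum_of_nonneg fun j _ => hp.1 j, hp.2, ENNReal.ofReal_one]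

lemma psum_nonneg (hp : ∀ j, 0 ≤ p j) (i : ℕ) : 0 ≤ psum n p i :=
  Finset.sum_nonneg fun j _ => by split_ifs <;> simp [hp j]

lemma psum_le_one (hp : IsPi n p) (i : ℕ) : psum n p i ≤ 1 := by
  rw [← hp.2]
  exact Finset.sum_le_sum fun j _ => by split_ifs <;> simp [hp.1 j]

lemma psum_succ (j : Fin n) : psum n p (j + 1) = psum n p j + p j := by
  have hsplit : ∀ k : Fin n, (if (k : ℕ) < j + 1 then p k else 0) =
      (if (k : ℕ) < j then p k else 0) + if k = j then p k else 0 := by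
    intro k
    rcases lt_trichotomy k j with h | rfl | h
    · have h' : (k : ℕ) < j := h
      simp [h', h.ne, Nat.lt_succ_of_lt h']
    · simp
    · have h' : (j : ℕ) < k := h
      simp [h.ne', not_lt.2 h'.le, not_lt.2 (Nat.succ_le_of_lt h')]
  simp only [psum, hsplit, Finset.sum_add_distrib, Finset.sum_ite_eq', Finset.mem_univ, if_true]

lemma psum_mono (hp : ∀ j, 0 ≤ p j) : Monotone (psum n p) := fun i k hik =>
  Finset.sum_le_sum fun j _ => by
    by_cases h : (j : ℕ) < i
    · simp [h, h.trans_le hik]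
    · simp only [h, if_false]
      split_ifs <;> simp [hp j]

lemma psum_succ_le_cdf_discr (hp : ∀ j, 0 ≤ p j) (hx : IsXi A B n x) (j : Fin n) :
    psum n p (j + 1) ≤ cdf (discr n x p) A B (x j) := by
  rw [cdf_discr hp hx.1, psum]
  refine Finset.sum_le_sum fun k _ => ?_
  by_cases h : (k : ℕ) < j + 1
  · have hk : x k ≤ x j := hx.2 (Fin.le_def.2 (Nat.lt_succ_iff.1 h))
    simp [h, hk]
  · simp only [h, if_false]
    split_ifs <;> simp [hp k]

lemma cdf_discr_le_psum (hp : ∀ j, 0 ≤ p j) (hx : IsXi A B n x) (j : Fin n) {s : ℝ}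
    (hs : s < x j) : cdf (discr n x p) A B s ≤ psum n p j := by
  rw [cdf_discr hp hx.1, psum]
  refine Finset.sum_le_sum fun k _ => ?_
  by_cases h : x k ≤ s
  · have hk : (k : ℕ) < j := by
      by_contra! hjk
      exact absurd (hs.trans_le (hx.2 (Fin.le_def.2 hjk))) (not_lt.2 h)
    simp [h, hk]
  · simp only [h, if_false]
    split_ifs <;> simp [hp k]

lemma cdf_discr_eq_zero_or_le_psum (hp : ∀ j, 0 ≤ p j) (hx : IsXi A B n x) (t : ℝ) :
    cdf (discr n x p) A B t = 0 ∨
      ∃ j, 0 < p j ∧ x j ≤ t ∧ cdf (discr n x p) A B t ≤ psum n p (j + 1) := by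
  rw [cdf_discr hp hx.1]
  rcases (Finset.univ.filter fun j => 0 < p j ∧ x j ≤ t).eq_empty_or_nonempty with he | hne
  · left
    refine Finset.sum_eq_zero fun k _ => ?_
    split_ifs with hk
    · by_contra hpk
      have hmem : k ∈ Finset.univ.filter fun j => 0 < p j ∧ x j ≤ t := by
        simp [hk, (hp k).lt_of_ne' hpk]
      simp [he] at hmem
    · rfl
  · right
    obtain ⟨j, hj, hmax⟩ := Finset.exists_max_image _ id hne
    simp only [Finset.mem_filter, Finset.mem_univ, true_and, id] at hj hmax
    refine ⟨j, hj.1, hj.2, Finset.sum_le_sum fun k _ => ?_⟩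
    rcases (hp k).eq_or_lt with hk0 | hk0
    · simp [← hk0]
    by_cases hk : x k ≤ t
    · have hkj : (k : ℕ) < j + 1 := Nat.lt_succ_iff.2 (hmax k ⟨hk0, hk⟩)
      simp [hk, hkj]
    · simp only [hk, if_false]
      split_ifs <;> simp [hp k]

lemma cdf_discr_eq_one_or_psum_le (hp : IsPi n p) (hx : IsXi A B n x) (t : ℝ) :
    cdf (discr n x p) A B t = 1 ∨
      ∃ j, 0 < p j ∧ t < x j ∧ psum n p j ≤ cdf (discr n x p) A B t := by
  rw [cdf_discr hp.1 hx.1]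
  rcases (Finset.univ.filter fun j => 0 < p j ∧ t < x j).eq_empty_or_nonempty with he | hne
  · left
    rw [← hp.2]
    refine Finset.sum_congr rfl fun k _ => ?_
    split_ifs with hk
    · rfl
    · by_contra hpk
      have hmem : k ∈ Finset.univ.filter fun j => 0 < p j ∧ t < x j := by
        simp [not_le.1 hk, (hp.1 k).lt_of_ne hpk]
      simp [he] at hmem
  · right
    obtain ⟨j, hj, hmin⟩ := Finset.exists_min_image _ id hne
    simp only [Finset.mem_filter, Finset.mem_univ, true_and, id] at hj hmin
    refine ⟨j, hj.1, hj.2, Finset.sum_le_sum fun k _ => ?_⟩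
    rcases (hp.1 k).eq_or_lt with hk0 | hk0
    · simp [← hk0]
    by_cases hk : x k ≤ t
    · simp only [hk, if_true]
      split_ifs <;> simp [hp.1 k]
    · have hkj : ¬ (k : ℕ) < j := not_lt.2 (hmin k ⟨hk0, not_le.1 hk⟩)
      simp [hk, hkj]

end Discrete

section Kolmogorov

variable {A B : ℝ} {μ : Measure ℝ} {n : ℕ} {x p : Fin n → ℝ}

lemma dKol_le_iff {ν : Measure ℝ} [IsProbabilityMeasure μ] [IsProbabilityMeasure ν] {K : ℝ} :
    dKol A B μ ν ≤ K ↔ ∀ t, |cdf μ A B t - cdf ν A B t| ≤ K := by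
  have hbdd : BddAbove (range fun t : ℝ => |cdf μ A B t - cdf ν A B t|) := by
    refine ⟨1, ?_⟩
    rintro _ ⟨t, rfl⟩
    have h1 := cdf_nonneg (μ := μ) (A := A) (B := B) t
    have h2 := cdf_le_one (μ := μ) (A := A) (B := B) t
    have h3 := cdf_nonneg (μ := ν) (A := A) (B := B) t
    have h4 := cdf_le_one (μ := ν) (A := A) (B := B) t
    exact abs_le.2 ⟨by linarith, by linarith⟩
  rw [dKol, csSup_le_iff hbdd (range_nonempty _), forall_mem_range]

lemma dKol_nonneg {ν : Measure ℝ} : 0 ≤ dKol A B μ ν :=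
  Real.sSup_nonneg (by rintro _ ⟨t, rfl⟩; exact abs_nonneg _)

lemma dKol_discr_le_iff_cdf [IsProbabilityMeasure μ] (hp : IsPi n p) (hx : IsXi A B n x)
    {K : ℝ} (hK : 0 ≤ K) :
    dKol A B μ (discr n x p) ≤ K ↔ ∀ j : Fin n, 0 < p j →
      psum n p (j + 1) - K ≤ cdf μ A B (x j) ∧ ∀ s < x j, cdf μ A B s ≤ psum n p j + K := by
  have := isProbabilityMeasure_discr (x := x) hp
  rw [dKol_le_iff]
  constructor
  · intro h j _
    refine ⟨?_, fun s hs => ?_⟩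
    · have h1 := (abs_le.1 (h (x j))).1
      have h2 := psum_succ_le_cdf_discr hp.1 hx j
      linarith
    · have h1 := (abs_le.1 (h s)).2
      have h2 := cdf_discr_le_psum hp.1 hx j hs
      linarith
  · intro h t
    rw [abs_le]
    constructor
    · rcases cdf_discr_eq_zero_or_le_psum hp.1 hx t with h0 | ⟨j, hj, hjt, hle⟩
      · have := cdf_nonneg (μ := μ) (A := A) (B := B) t
        linarith
      · have h1 := (h j hj).1
        have h2 := cdf_mono (μ := μ) (A := A) (B := B) hjt
        linarith
    · rcases cdf_discr_eq_one_or_psum_le hp hx t with h1 | ⟨j, hj, hjt, hle⟩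
      · have := cdf_le_one (μ := μ) (A := A) (B := B) t
        linarith
      · have h1 := (h j hj).2 t hjt
        linarith

lemma dKol_discr_le_iff_quant [IsProbabilityMeasure μ] (hAB : A ≤ B) (hμ : μ (Icc A B) = 1)
    (hp : IsPi n p) (hx : IsXi A B n x) {K : ℝ} (hK : 0 ≤ K) :
    dKol A B μ (discr n x p) ≤ K ↔
      ∀ j : Fin n, psum n p (j : ℕ) < psum n p ((j : ℕ) + 1) →
        quantm μ A B (psum n p ((j : ℕ) + 1) - K) ≤ x j ∧
          x j ≤ quant μ A B (psum n p (j : ℕ) + K) := by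
  rw [dKol_discr_le_iff_cdf hp hx hK]
  refine forall_congr' fun j => ?_
  have h1 := psum_le_one hp (j + 1)
  have h0 := psum_nonneg hp.1 (j : ℕ)
  rw [quantm_le_iff hAB hμ (hx.1 j) (by linarith), le_quant_iff hAB (hx.1 j) (by linarith),
    psum_succ, lt_add_iff_pos_right]

lemma isXi_xiPts [IsFiniteMeasure μ] (hAB : A ≤ B) (hp : ∀ j, 0 ≤ p j) :
    IsXi A B n (xiPts μ A B n p) := by
  refine ⟨fun j => quant_mem_Icc hAB _, fun i j hij => quant_mono hAB ?_⟩
  have h1 : psum n p (i : ℕ) ≤ psum n p (j : ℕ) := psum_mono hp hij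
  have h2 : psum n p ((i : ℕ) + 1) ≤ psum n p ((j : ℕ) + 1) :=
    psum_mono hp (Nat.succ_le_succ hij)
  linarith

/-- The locations `ξ(p)` are a best approximation given the weights `p`. -/
lemma Kwei_le_dKol [IsProbabilityMeasure μ] (hAB : A ≤ B) (hμ : μ (Icc A B) = 1)
    (hp : IsPi n p) (hx : IsXi A B n x) :
    Kwei μ A B n p ≤ dKol A B μ (discr n x p) := by
  set K := dKol A B μ (discr n x p) with hKdef
  have hK : 0 ≤ K := dKol_nonneg
  have hcond := (dKol_discr_le_iff_cdf hp hx hK).1 hKdef.symm.le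
  rw [Kwei, dKol_discr_le_iff_cdf hp (isXi_xiPts hAB hp.1) hK]
  intro j hj
  obtain ⟨hlow, hup⟩ := hcond j hj
  have h0 := psum_nonneg hp.1 (j : ℕ)
  have h0' := psum_nonneg hp.1 ((j : ℕ) + 1)
  have h1 := psum_le_one hp (j : ℕ)
  have h1' := psum_le_one hp ((j : ℕ) + 1)
  set m := (psum n p (j : ℕ) + psum n p ((j : ℕ) + 1)) / 2 with hm
  have hm0 : 0 ≤ m := by linarith
  have hm1 : m ≤ 1 := by linarith
  have hxi : xiPts μ A B n p j = quant μ A B m := rfl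
  rw [hxi]
  rcases le_or_gt (psum n p ((j : ℕ) + 1) - K) m with hle | hlt
  · refine ⟨hle.trans (le_cdf_quant hAB hμ hm1), fun s hs => ?_⟩
    have := cdf_le_of_lt_quant hAB hm0 hs
    linarith
  · have hxj : quant μ A B m = x j := by
      refine le_antisymm ?_ ?_
      · by_contra! h
        have := cdf_le_of_lt_quant hAB hm0 h
        linarith
      · rw [le_quant_iff hAB (hx.1 j) hm0]
        intro s hs
        have := hup s hs
        linarith
    rw [hxj]
    exact ⟨hlow, hup⟩

end Kolmogorov

/-- Thm. 5.4: existence and characterization of best Kolmogorov-distance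
approximations of `μ` with prescribed weights `p ∈ Π_n`. -/
theorem best_dKol_given_weights (A B : ℝ) (hAB : A < B) (μ : Measure ℝ)
    [IsProbabilityMeasure μ] (hμ : μ (Icc A B) = 1) (n : ℕ) (hn : 0 < n)
    (p : Fin n → ℝ) (hp : IsPi n p) :
    (∃ x : Fin n → ℝ, IsXi A B n x ∧ ∀ y : Fin n → ℝ, IsXi A B n y →
      dKol A B μ (discr n x p) ≤ dKol A B μ (discr n y p)) ∧
    ∀ x : Fin n → ℝ, IsXi A B n x →
      (((∀ y : Fin n → ℝ, IsXi A B n y →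
          dKol A B μ (discr n x p) ≤ dKol A B μ (discr n y p)) ↔
        (∀ j : Fin n, psum n p (j : ℕ) < psum n p ((j : ℕ) + 1) →
          quantm μ A B (psum n p ((j : ℕ) + 1) - Kwei μ A B n p) ≤ x j ∧
            x j ≤ quant μ A B (psum n p (j : ℕ) + Kwei μ A B n p))) ∧
      ((∀ y : Fin n → ℝ, IsXi A B n y →
          dKol A B μ (discr n x p) ≤ dKol A B μ (discr n y p)) →
        dKol A B μ (discr n x p) = Kwei μ A B n p)) := by
  have hmin : ∀ y : Fin n → ℝ, IsXi A B n y → Kwei μ A B n p ≤ dKol A B μ (discr n y p) :=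
    fun y hy => Kwei_le_dKol hAB.le hμ hp hy
  have hxi : IsXi A B n (xiPts μ A B n p) := isXi_xiPts hAB.le hp.1
  refine ⟨⟨_, hxi, hmin⟩, fun x hx => ⟨?_, fun h => le_antisymm (h _ hxi) (hmin x hx)⟩⟩
  rw [← dKol_discr_le_iff_quant hAB.le hμ hp hx (K := Kwei μ A B n p) dKol_nonneg]
  exact ⟨fun h => h _ hxi, fun h y hy => h.trans (hmin y hy)⟩

end BenfordApprox
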